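/- Fix natural numbers k, l and a natural number n with n ≥ 4. Call a Setoid π on Fin l ⊕ Fin k crossing if, identifying Fin l ⊕ Fin k with Fin (l + k) via the equivalence finSumFinEquiv (so that the top-row elements are labelled 1,…,l from left to right and the bottom-row elements are labelled l+1,…,l+k from left to right), there exist x₁ < x₂ < x₃ < x₄ in Fin (l + k) such that x₁ and x₃ are π-related, x₂ and x₄ are π-related, but x₁ and x₂ are not π-related; otherwise call π non-crossing. Then the family of partition matrices (D_π), indexed by the non-crossing Setoids π on Fin l ⊕ Fin k, is linearly independent over ℂ. (This is the statement that for n ≥ 4 the spanning sets of equivariant weight matrices for the free easy orthogonal compact matrix quantum groups are bases.) -/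

import Mathlib

open scoped Classical

/-- The partition matrix `D_π` of a set partition (Setoid) `π` of `α ⊕ β`:
`D_π I J = 1` if `Sum.elim I J` is constant on every block of `π`, else `0`. -/
noncomputable def Dmat (n : ℕ) {α β : Type*} (π : Setoid (α ⊕ β)) :
    Matrix (α → Fin n) (β → Fin n) ℂ :=
  Matrix.of fun I J =>
    if ∀ x y : α ⊕ β, π.r x y → Sum.elim I J x = Sum.elim I J y then 1 else 0

/-- A set partition (Setoid) `π` of `Fin l ⊕ Fin k` is crossing if, identifying
`Fin l ⊕ Fin k` with `Fin (l + k)` via `finSumFinEquiv`, there are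
`x₁ < x₂ < x₃ < x₄` with `x₁ ~ x₃`, `x₂ ~ x₄` but `¬ x₁ ~ x₂`. -/
def Crossing (k l : ℕ) (π : Setoid (Fin l ⊕ Fin k)) : Prop :=
  ∃ x₁ x₂ x₃ x₄ : Fin (l + k), x₁ < x₂ ∧ x₂ < x₃ ∧ x₃ < x₄ ∧
    π.r (finSumFinEquiv.symm x₁) (finSumFinEquiv.symm x₃) ∧
    π.r (finSumFinEquiv.symm x₂) (finSumFinEquiv.symm x₄) ∧
    ¬ π.r (finSumFinEquiv.symm x₁) (finSumFinEquiv.symm x₂)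

/-! ### Non-crossing words -/

/-- A word is non-crossing if it contains no subword `a b a b` with `a ≠ b`. -/
def NonCrossingWord {ι : Type*} (L : List ι) : Prop :=
  ∀ a b, [a, b, a, b].Sublist L → a = b

theorem NonCrossingWord.sublist {ι : Type*} {L L' : List ι} (h : NonCrossingWord L)
    (hL : L'.Sublist L) : NonCrossingWord L' :=
  fun a b hab => h a b (hab.trans hL)

/-- A nonempty non-crossing word has two equal adjacent letters or a letter occurring only once. -/
theorem NonCrossingWord.exists_adjacent_or_unique {α ι : Type*} (f : α → ι) :
    ∀ (N : ℕ) (L : List α), L.length ≤ N → L ≠ [] → NonCrossingWord (L.map f) →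
      (∃ L₁ x y L₂, L = L₁ ++ x :: y :: L₂ ∧ f x = f y) ∨
      (∃ L₁ x L₂, L = L₁ ++ x :: L₂ ∧ (∀ y ∈ L₁, f y ≠ f x) ∧ ∀ y ∈ L₂, f y ≠ f x) := by
  intro N
  induction N with
  | zero => intro L h0 h1; exact absurd (List.length_eq_zero_iff.mp (Nat.le_zero.mp h0)) h1
  | succ N ih =>
    intro L hlen hne hnc
    obtain ⟨x, L', rfl⟩ := List.exists_cons_of_ne_nil hne
    by_cases hx : f x ∈ L'.map f
    · obtain ⟨s, t, hst, hs⟩ := List.eq_append_cons_of_mem hx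
      obtain ⟨M, R, rfl, rfl, hR⟩ := List.map_eq_append_iff.mp hst
      obtain ⟨z, R, rfl, hz, rfl⟩ := List.map_eq_cons_iff.mp hR
      rcases eq_or_ne M [] with rfl | hM
      · exact Or.inl ⟨[], x, z, R, rfl, hz.symm⟩
      · have hMnc : NonCrossingWord (M.map f) := hnc.sublist <| by
          apply List.Sublist.map
          exact (List.sublist_append_left _ _).trans (List.sublist_cons_self _ _)
        have hMlen : M.length ≤ N := by simp at hlen; omega
        rcases ih M hMlen hM hMnc with ⟨L₁, u, v, L₂, rfl, huv⟩ | ⟨L₁, u, L₂, rfl, h₁, h₂⟩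
        · exact Or.inl ⟨x :: L₁, u, v, L₂ ++ z :: R, by simp, huv⟩
        · refine Or.inr ⟨x :: L₁, u, L₂ ++ z :: R, by simp, ?_, ?_⟩
          · have hux : f x ≠ f u := fun h => hs (by simp [h])
            simpa [hux] using h₁
          · have hux : f x ≠ f u := fun h => hs (by simp [h])
            intro y hy
            rcases List.mem_append.mp hy with hy | hy
            · exact h₂ y hy
            · rcases List.mem_cons.mp hy with rfl | hy
              · rwa [hz]
              · intro hyu
                apply hux
                apply hnc
                have h3 : [f u].Sublist (R.map f) :=
                  List.singleton_sublist.mpr (List.mem_map.mpr ⟨y, hy, hyu⟩)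
                have h4 : [f u].Sublist ((L₁ ++ u :: L₂).map f) :=
                  List.singleton_sublist.mpr (by simp)
                have h5 := h4.append (h3.cons_cons (f x))
                rw [List.map_cons, List.map_append, List.map_cons, hz]
                exact h5.cons_cons (f x)
    · exact Or.inr ⟨[], x, L', rfl, by simp, fun y hy h => hx (List.mem_map.mpr ⟨y, hy, h⟩)⟩

/-! ### Twirling by the four Pauli matrices -/

/-- The real Pauli matrices `1`, `X`, `Z`, `XZ`. -/
def pauli : Fin 4 → Matrix Bool Bool ℂ :=
  ![1, Matrix.of fun a b => if a = b then 0 else 1,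
    Matrix.of fun a b => if a = b then (if a then 1 else -1) else 0,
    Matrix.of fun a b => if a = b then 0 else (if a then 1 else -1)]

theorem pauli_transpose_mul_self (i : Fin 4) : (pauli i).transpose * pauli i = 1 := by
  fin_cases i <;> ext a b <;> cases a <;> cases b <;>
    simp [pauli, Matrix.mul_apply]

theorem sum_pauli_conj (M : Matrix Bool Bool ℂ) :
    ∑ i, pauli i * M * (pauli i).transpose = (2 * M.trace) • (1 : Matrix Bool Bool ℂ) := by
  ext a b
  cases a <;> cases b <;>
    simp [pauli, Matrix.mul_apply, Fin.sum_univ_four, Matrix.trace] <;> ring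

/-! ### Segments and their amplitudes -/

/-- A run of consecutive points in the block `label`, reduced to its two outer legs. -/
structure Segment (ι T : Type*) where
  /-- The block containing the segment. -/
  label : ι
  /-- The leftmost leg. -/
  left : T
  /-- The rightmost leg. -/
  right : T

namespace Segment

variable {ι T : Type*}

/-- The matrix unit prescribed by the signs `w` of the legs, conjugated by the Pauli matrix
given by the colour of the block. -/
noncomputable def letter (w : T → Bool) (c : ι → Fin 4) (x : Segment ι T) :
    Matrix Bool Bool ℂ :=
  pauli (c x.label) * Matrix.single (w x.left) (!w x.right) 1 * (pauli (c x.label)).transpose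

/-- The sum over all block colourings of the product of the letters. -/
noncomputable def amplitude [Fintype ι] (w : T → Bool) (L : List (Segment ι T)) :
    Matrix Bool Bool ℂ :=
  ∑ c : ι → Fin 4, (L.map (letter w c)).prod

theorem letter_mul_letter (w : T → Bool) (c : ι → Fin 4) {x y : Segment ι T}
    (h : x.label = y.label) :
    letter w c x * letter w c y =
      if w x.right = w y.left then 0 else letter w c ⟨x.label, x.left, y.right⟩ := by
  have key : letter w c x * letter w c y =
      pauli (c x.label) * (Matrix.single (w x.left) (!w x.right) 1 *
        Matrix.single (w y.left) (!w y.right) 1) * (pauli (c x.label)).transpose := by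
    have := pauli_transpose_mul_self (c x.label)
    unfold letter
    rw [← h]
    simp only [← mul_assoc]
    rw [mul_assoc _ (pauli (c x.label)).transpose, this, mul_one]
  rw [key]
  split_ifs with hw
  · rw [Matrix.single_mul_single_of_ne] <;> simp [hw]
  · have : (!w x.right) = w y.left := by
      revert hw; cases w x.right <;> cases w y.left <;> simp
    rw [this, Matrix.single_mul_single_same]
    simp [letter]

theorem amplitude_merge [Fintype ι] (w : T → Bool) (L₁ L₂ : List (Segment ι T))
    {x y : Segment ι T} (h : x.label = y.label) :
    amplitude w (L₁ ++ x :: y :: L₂) =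
      if w x.right = w y.left then 0
      else amplitude w (L₁ ++ ⟨x.label, x.left, y.right⟩ :: L₂) := by
  have key (c : ι → Fin 4) : ((L₁ ++ x :: y :: L₂).map (letter w c)).prod =
      (L₁.map (letter w c)).prod * ((letter w c x * letter w c y) *
        (L₂.map (letter w c)).prod) := by
    simp [mul_assoc]
  simp only [amplitude, key, letter_mul_letter w _ h]
  split_ifs <;> simp

theorem amplitude_erase [Fintype ι] (w : T → Bool) (L₁ L₂ : List (Segment ι T))
    {x : Segment ι T} (h₁ : ∀ y ∈ L₁, y.label ≠ x.label) (h₂ : ∀ y ∈ L₂, y.label ≠ x.label) :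
    (4 : ℂ) • amplitude w (L₁ ++ x :: L₂) =
      if w x.left = w x.right then 0 else (2 : ℂ) • amplitude w (L₁ ++ L₂) := by
  have shift (i : Fin 4) : amplitude w (L₁ ++ x :: L₂) =
      ∑ c : ι → Fin 4, (L₁.map (letter w c)).prod *
        (letter w (c + Pi.single x.label i) x * (L₂.map (letter w c)).prod) := by
    unfold amplitude
    rw [← Equiv.sum_comp (Equiv.addRight (Pi.single x.label i : ι → Fin 4))]
    refine Finset.sum_congr rfl fun c _ => ?_
    have hL (L : List (Segment ι T)) (hL : ∀ y ∈ L, y.label ≠ x.label) :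
        L.map (letter w (c + Pi.single x.label i)) = L.map (letter w c) :=
      List.map_congr_left fun y hy => by simp [letter, Pi.single_eq_of_ne (hL y hy)]
    simp only [Equiv.coe_addRight, List.map_append, List.map_cons, List.prod_append,
      List.prod_cons, hL L₁ h₁, hL L₂ h₂]
  have twirl (c : ι → Fin 4) : ∑ i, letter w (c + Pi.single x.label i) x =
      (2 * (Matrix.single (w x.left) (!w x.right) (1 : ℂ)).trace) • 1 := by
    rw [← sum_pauli_conj, ← Equiv.sum_comp (Equiv.addLeft (c x.label))
      fun i => pauli i * Matrix.single (w x.left) (!w x.right) 1 * (pauli i).transpose]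
    simp [letter]
  have four : (4 : ℂ) • amplitude w (L₁ ++ x :: L₂) =
      ∑ _i : Fin 4, amplitude w (L₁ ++ x :: L₂) := by
    rw [Finset.sum_const, Finset.card_univ, Fintype.card_fin, ← Nat.cast_smul_eq_nsmul ℂ]
    norm_num
  rw [four, Finset.sum_congr rfl fun i _ => shift i, Finset.sum_comm]
  simp only [← Finset.mul_sum, ← Finset.sum_mul, twirl]
  split_ifs with hw
  · have : w x.left ≠ !w x.right := by rw [hw]; simp
    simp [Matrix.trace_single_eq_of_ne _ _ _ this]
  · have : (!w x.right) = w x.left := by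
      revert hw; cases w x.right <;> cases w x.left <;> simp
    simp [this, amplitude, Finset.smul_sum]

/-- The signed weight of the legs. -/
def area (pos : T → ℤ) (w : T → Bool) (L : List (Segment ι T)) : ℤ :=
  (L.map fun x => (if w x.left then -pos x.left else pos x.left) +
    (if w x.right then -pos x.right else pos x.right)).sum

/-- The sign pattern `v` marks the opening and closing legs of a non-crossing list of segments:
a left leg is closing iff its block occurs earlier, a right leg is opening iff its block
occurs later. -/
structure Marked (pos : T → ℤ) (v : T → Bool) (L : List (Segment ι T)) : Prop where
  lt : ∀ x ∈ L, pos x.left < pos x.right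
  sorted : L.Pairwise fun x y => pos x.right < pos y.left
  nonCrossing : NonCrossingWord (L.map label)
  inner : L.Pairwise fun x y => x.label = y.label → v x.right = true ∧ v y.left = false
  first : ∀ x ∈ L, v x.left = false → ∃ y ∈ L, y.label = x.label ∧ pos y.left < pos x.left
  last : ∀ x ∈ L, v x.right = true → ∃ y ∈ L, y.label = x.label ∧ pos x.right < pos y.right

theorem Marked.erase {pos : T → ℤ} {v : T → Bool} {L₁ L₂ : List (Segment ι T)}
    {x : Segment ι T} (h : Marked pos v (L₁ ++ x :: L₂))
    (h₁ : ∀ y ∈ L₁, y.label ≠ x.label) (h₂ : ∀ y ∈ L₂, y.label ≠ x.label) :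
    Marked pos v (L₁ ++ L₂) := by
  have hsub : (L₁ ++ L₂).Sublist (L₁ ++ x :: L₂) :=
    (List.Sublist.refl _).append (List.sublist_cons_self _ _)
  have hne : ∀ y ∈ L₁ ++ L₂, y.label ≠ x.label := fun y hy =>
    (List.mem_append.mp hy).elim (h₁ y) (h₂ y)
  have hmem : ∀ y ∈ L₁ ++ x :: L₂, y.label ≠ x.label → y ∈ L₁ ++ L₂ := by
    intro y hy hyx
    rcases List.mem_append.mp hy with hy | hy
    · exact List.mem_append_left _ hy
    · rcases List.mem_cons.mp hy with rfl | hy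
      · exact absurd rfl hyx
      · exact List.mem_append_right _ hy
  refine ⟨fun y hy => h.lt y (hsub.subset hy), h.sorted.sublist hsub,
    h.nonCrossing.sublist (hsub.map _), h.inner.sublist hsub, fun y hy hv => ?_, fun y hy hv => ?_⟩
  · obtain ⟨z, hz, hzy, hpos⟩ := h.first y (hsub.subset hy) hv
    exact ⟨z, hmem z hz (hzy ▸ hne y hy), hzy, hpos⟩
  · obtain ⟨z, hz, hzy, hpos⟩ := h.last y (hsub.subset hy) hv
    exact ⟨z, hmem z hz (hzy ▸ hne y hy), hzy, hpos⟩

theorem Marked.merge {pos : T → ℤ} {v : T → Bool} {L₁ L₂ : List (Segment ι T)}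
    {x y : Segment ι T} (h : Marked pos v (L₁ ++ x :: y :: L₂)) (hxy : x.label = y.label) :
    Marked pos v (L₁ ++ ⟨x.label, x.left, y.right⟩ :: L₂) := by
  obtain ⟨hlt, hs, hnc, hi, hf, hl⟩ := h
  simp only [List.pairwise_append, List.pairwise_cons, List.mem_cons, List.mem_append]
    at hs hi hlt hf hl
  have hx := hlt x (by simp)
  have hy := hlt y (by simp)
  have hxy' := hs.2.1.1 y (by simp)
  refine ⟨?_, ?_, ?_, ?_, ?_, ?_⟩
  · intro u hu
    simp only [List.mem_append, List.mem_cons] at hu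
    rcases hu with hu | rfl | hu
    · exact hlt u (by simp [hu])
    · simp only; omega
    · exact hlt u (by simp [hu])
  · simp only [List.pairwise_append, List.pairwise_cons, List.mem_cons]
    grind
  · refine hnc.sublist ?_
    simp only [List.map_append, List.map_cons]
    exact (List.Sublist.refl _).append ((List.sublist_cons_self _ _).cons_cons _)
  · simp only [List.pairwise_append, List.pairwise_cons, List.mem_cons]
    grind
  · intro u hu hv
    obtain ⟨u', hu', hlab, hleft⟩ : ∃ u', (u' ∈ L₁ ∨ u' = x ∨ u' = y ∨ u' ∈ L₂) ∧
        u'.label = u.label ∧ u'.left = u.left := by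
      simp only [List.mem_append, List.mem_cons] at hu
      rcases hu with hu | rfl | hu
      exacts [⟨u, by simp [hu]⟩, ⟨x, by simp⟩, ⟨u, by simp [hu]⟩]
    obtain ⟨z, hz, hzu, hpos⟩ := hf u' hu' (hleft ▸ hv)
    rw [hlab] at hzu
    rw [hleft] at hpos
    rcases hz with hz | rfl | rfl | hz
    · exact ⟨z, by simp [hz], hzu, hpos⟩
    · exact ⟨_, List.mem_append_right _ List.mem_cons_self, hzu, hpos⟩
    · exact ⟨_, List.mem_append_right _ List.mem_cons_self, hxy.trans hzu, by simp only; omega⟩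
    · exact ⟨z, by simp [hz], hzu, hpos⟩
  · intro u hu hv
    obtain ⟨u', hu', hlab, hright⟩ : ∃ u', (u' ∈ L₁ ∨ u' = x ∨ u' = y ∨ u' ∈ L₂) ∧
        u'.label = u.label ∧ u'.right = u.right := by
      simp only [List.mem_append, List.mem_cons] at hu
      rcases hu with hu | rfl | hu
      exacts [⟨u, by simp [hu]⟩, ⟨y, by simp [hxy]⟩, ⟨u, by simp [hu]⟩]
    obtain ⟨z, hz, hzu, hpos⟩ := hl u' hu' (hright ▸ hv)
    rw [hlab] at hzu
    rw [hright] at hpos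
    rcases hz with hz | rfl | rfl | hz
    · exact ⟨z, by simp [hz], hzu, hpos⟩
    · exact ⟨_, List.mem_append_right _ List.mem_cons_self, hzu, by simp only; omega⟩
    · exact ⟨_, List.mem_append_right _ List.mem_cons_self, hxy.trans hzu, hpos⟩
    · exact ⟨z, by simp [hz], hzu, hpos⟩

/-- The marking maximizes the area among all sign patterns of nonzero amplitude, uniquely. -/
theorem Marked.amplitude_spec [Fintype ι] {pos : T → ℤ} {v : T → Bool} :
    ∀ {L : List (Segment ι T)}, Marked pos v L → amplitude v L ≠ 0 ∧
      ∀ w, amplitude w L ≠ 0 → area pos w L ≤ area pos v L ∧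
        (area pos w L = area pos v L →
          ∀ x ∈ L, w x.left = v x.left ∧ w x.right = v x.right) := by
  intro L
  induction hN : L.length using Nat.strong_induction_on generalizing L with
  | _ N ih =>
  intro h
  rcases eq_or_ne L [] with rfl | hne
  · refine ⟨?_, fun w _ => by simp [area]⟩
    simp only [amplitude, List.map_nil, List.prod_nil, Finset.sum_const]
    rw [← Nat.cast_smul_eq_nsmul ℂ]
    exact smul_ne_zero (by simp) one_ne_zero
  rcases NonCrossingWord.exists_adjacent_or_unique label N L hN.le hne h.nonCrossing with
    ⟨L₁, x, y, L₂, rfl, hxy⟩ | ⟨L₁, x, L₂, rfl, h₁, h₂⟩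
  · obtain ⟨ih₁, ih₂⟩ := ih _ (by rw [← hN]; simp) rfl (h.merge hxy)
    have hpos : pos x.right < pos y.left := by
      have := h.sorted
      simp only [List.pairwise_append, List.pairwise_cons, List.mem_cons] at this
      exact this.2.1.1 y (by simp)
    obtain ⟨hvx, hvy⟩ : v x.right = true ∧ v y.left = false := by
      have := h.inner
      simp only [List.pairwise_append, List.pairwise_cons, List.mem_cons] at this
      exact this.2.1.1 y (by simp) hxy
    refine ⟨by rw [amplitude_merge _ _ _ hxy]; simpa [hvx, hvy] using ih₁, fun w hw => ?_⟩
    rw [amplitude_merge _ _ _ hxy] at hw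
    split_ifs at hw with hwxy
    · exact absurd rfl hw
    obtain ⟨hle, heq⟩ := ih₂ w hw
    simp only [area, List.map_append, List.map_cons, List.sum_append, List.sum_cons, hvx, hvy,
      List.mem_append, List.mem_cons] at hle heq ⊢
    cases hwx : w x.right <;> cases hwy : w y.left
    · simp [hwx, hwy] at hwxy
    · simp only [if_true, Bool.false_eq_true, if_false]
      exact ⟨by linarith, fun h => by linarith⟩
    · simp only [if_true, Bool.false_eq_true, if_false]
      refine ⟨by linarith, fun h => ?_⟩
      have hall := heq (by linarith)
      have hz := hall _ (Or.inr (Or.inl rfl))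
      rintro z (hz' | rfl | rfl | hz')
      exacts [hall z (Or.inl hz'), ⟨hz.1, by rw [hwx, hvx]⟩, ⟨by rw [hwy, hvy], hz.2⟩,
        hall z (Or.inr (Or.inr hz'))]
    · simp [hwx, hwy] at hwxy
  · obtain ⟨ih₁, ih₂⟩ := ih _ (by rw [← hN]; simp) rfl (h.erase h₁ h₂)
    have hpos := h.lt x (by simp)
    have hvl : v x.left = true := by
      by_contra hv
      obtain ⟨z, hz, hzx, hlt⟩ := h.first x (by simp) (by simpa using hv)
      simp only [List.mem_append, List.mem_cons] at hz
      rcases hz with hz | rfl | hz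
      exacts [h₁ z hz hzx, lt_irrefl _ hlt, h₂ z hz hzx]
    have hvr : v x.right = false := by
      by_contra hv
      obtain ⟨z, hz, hzx, hlt⟩ := h.last x (by simp) (by simpa using hv)
      simp only [List.mem_append, List.mem_cons] at hz
      rcases hz with hz | rfl | hz
      exacts [h₁ z hz hzx, lt_irrefl _ hlt, h₂ z hz hzx]
    refine ⟨fun h0 => ?_, fun w hw => ?_⟩
    · have := amplitude_erase v L₁ L₂ h₁ h₂
      rw [h0, smul_zero, if_neg (by simp [hvl, hvr])] at this
      exact smul_ne_zero two_ne_zero ih₁ this.symm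
    have he := amplitude_erase w L₁ L₂ h₁ h₂
    have hwx : w x.left ≠ w x.right := fun hwx => by simp [hwx, hw] at he
    rw [if_neg hwx] at he
    obtain ⟨hle, heq⟩ := ih₂ w fun h0 => by simp [h0, hw] at he
    simp only [area, List.map_append, List.map_cons, List.sum_append, List.sum_cons, hvl, hvr,
      List.mem_append, List.mem_cons] at hle heq ⊢
    cases hwl : w x.left <;> cases hwr : w x.right
    · simp [hwl, hwr] at hwx
    · simp only [if_true, Bool.false_eq_true, if_false]
      exact ⟨by linarith, fun h => by linarith⟩
    · simp only [if_true, Bool.false_eq_true, if_false]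
      refine ⟨by linarith, fun h => ?_⟩
      have hall := heq (by linarith)
      rintro z (hz | rfl | hz)
      exacts [hall z (Or.inl hz), ⟨by rw [hwl, hvl], by rw [hwr, hvr]⟩, hall z (Or.inr hz)]
    · simp [hwl, hwr] at hwx

end Segment

/-! ### Non-crossing partitions of `Fin m` -/

/-- A partition of `Fin m` without crossings. -/
def NonCrossingSetoid {m : ℕ} (p : Setoid (Fin m)) : Prop :=
  ∀ x₁ x₂ x₃ x₄, x₁ < x₂ → x₂ < x₃ → x₃ < x₄ → p x₁ x₃ → p x₂ x₄ → p x₁ x₂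

/-- The opening (`true`) and closing (`false`) legs of a partition; each point `x` has a left leg
`(x, false)` and a right leg `(x, true)`. -/
noncomputable def legSign {m : ℕ} (p : Setoid (Fin m)) (t : Fin m × Bool) : Bool :=
  if t.2 then decide (∃ y, t.1 < y ∧ p t.1 y) else decide (∀ y, y < t.1 → ¬ p y t.1)

/-- The position of a leg. -/
def legPos {m : ℕ} (t : Fin m × Bool) : ℤ := 2 * (t.1 : ℤ) + if t.2 then 1 else 0

/-- The points of `Fin m`, labelled by the blocks of `p`, as a list of segments. -/
def segments {m : ℕ} (p : Setoid (Fin m)) : List (Segment (Quotient p) (Fin m × Bool)) :=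
  (List.finRange m).map fun x => ⟨⟦x⟧, (x, false), (x, true)⟩

theorem NonCrossingSetoid.marked {m : ℕ} {p : Setoid (Fin m)} (hp : NonCrossingSetoid p) :
    Segment.Marked legPos (legSign p) (segments p) := by
  have hsorted : (List.finRange m).Pairwise (· < ·) := List.pairwise_lt_finRange m
  refine ⟨?_, ?_, ?_, ?_, ?_, ?_⟩
  · simp [segments, legPos]
  · rw [segments, List.pairwise_map]
    refine hsorted.imp fun {x y} hxy => ?_
    have : (x : ℕ) < y := hxy
    simp only [legPos, if_true, Bool.false_eq_true, if_false]
    omega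
  · intro a b hab
    rw [segments, List.map_map] at hab
    obtain ⟨L, hL, hLab⟩ := List.sublist_map_iff.mp hab
    have hs := hsorted.sublist hL
    obtain ⟨x₁, L, rfl, rfl, hLab⟩ := List.map_eq_cons_iff.mp hLab.symm
    obtain ⟨x₂, L, rfl, rfl, hLab⟩ := List.map_eq_cons_iff.mp hLab
    obtain ⟨x₃, L, rfl, h₃, hLab⟩ := List.map_eq_cons_iff.mp hLab
    obtain ⟨x₄, L, rfl, h₄, -⟩ := List.map_eq_cons_iff.mp hLab
    simp only [List.pairwise_cons, List.mem_cons] at hs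
    exact Quotient.sound (hp x₁ x₂ x₃ x₄ (hs.1 _ (by simp)) (hs.2.1 _ (by simp))
      (hs.2.2.1 _ (by simp)) (Quotient.exact h₃.symm) (Quotient.exact h₄.symm))
  · rw [segments, List.pairwise_map]
    refine hsorted.imp fun {x y} hxy h => ?_
    have h : p x y := Quotient.exact h
    simpa [legSign] using ⟨⟨y, hxy, h⟩, ⟨x, hxy, h⟩⟩
  · simp only [segments, List.mem_map, List.mem_finRange, true_and]
    rintro _ ⟨x, rfl⟩ hx
    simp only [legSign, Bool.false_eq_true, if_false, decide_eq_false_iff_not, not_forall,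
      not_not] at hx
    obtain ⟨y, hyx, h⟩ := hx
    have : (y : ℕ) < x := hyx
    exact ⟨_, ⟨y, rfl⟩, Quotient.sound h, by simpa [legPos] using this⟩
  · simp only [segments, List.mem_map, List.mem_finRange, true_and]
    rintro _ ⟨x, rfl⟩ hx
    simp only [legSign, if_true, decide_eq_true_eq] at hx
    obtain ⟨y, hxy, h⟩ := hx
    have : (x : ℕ) < y := hxy
    exact ⟨_, ⟨y, rfl⟩, Quotient.sound (p.symm h), by simpa [legPos] using this⟩

/-- A non-crossing partition is determined by its opening and closing legs. -/
theorem NonCrossingSetoid.eq_of_legSign_eq {m : ℕ} {p q : Setoid (Fin m)}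
    (hp : NonCrossingSetoid p) (hq : NonCrossingSetoid q) (h : legSign p = legSign q) :
    p = q := by
  have hlater (x : Fin m) : (∃ y, x < y ∧ p x y) ↔ ∃ y, x < y ∧ q x y := by
    simpa [legSign] using congrFun h (x, true)
  have hearlier (x : Fin m) : (∃ y, y < x ∧ p y x) ↔ ∃ y, y < x ∧ q y x := by
    rw [← not_iff_not]
    simpa [legSign] using congrFun h (x, false)
  have step (p q : Setoid (Fin m)) (hq : NonCrossingSetoid q)
      (hlater : ∀ x, (∃ y, x < y ∧ p x y) → ∃ y, x < y ∧ q x y)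
      (hearlier : ∀ x, (∃ y, y < x ∧ p y x) → ∃ y, y < x ∧ q y x) (x y : Fin m)
      (ih : ∀ x' y' : Fin m, x' < y' → (y' : ℕ) - x' < y - x → (p x' y' ↔ q x' y'))
      (hxy : x < y) (hpxy : p x y) : q x y := by
    by_cases hz : ∃ z, x < z ∧ z < y ∧ p x z
    · obtain ⟨z, hxz, hzy, hpz⟩ := hz
      exact q.trans ((ih x z hxz (by omega)).mp hpz)
        ((ih z y hzy (by omega)).mp (p.trans (p.symm hpz) hpxy))
    push Not at hz
    obtain ⟨u, hu, hqu⟩ := hearlier y ⟨x, hxy, hpxy⟩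
    obtain ⟨t, ht, hqt⟩ := hlater x ⟨y, hxy, hpxy⟩
    rcases lt_trichotomy u x with hux | rfl | hux
    · rcases lt_trichotomy t y with hty | rfl | hty
      · exact absurd ((ih x t ht (by omega)).mpr hqt) (hz t ht hty)
      · exact hqt
      · exact q.trans (q.symm (hq u x y t hux hxy hty hqu hqt)) hqu
    · exact hqu
    · exact absurd (p.trans hpxy (p.symm ((ih u y hu (by omega)).mpr hqu))) (hz u hux hu)
  have main (d : ℕ) : ∀ x y : Fin m, x < y → (y : ℕ) - x = d → (p x y ↔ q x y) := by
    induction d using Nat.strong_induction_on with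
    | _ d ih =>
    intro x y hxy hd
    exact ⟨step p q hq (fun x => (hlater x).mp) (fun x => (hearlier x).mp) x y
        (fun x' y' h1 h2 => ih _ (hd ▸ h2) x' y' h1 rfl) hxy,
      step q p hp (fun x => (hlater x).mpr) (fun x => (hearlier x).mpr) x y
        (fun x' y' h1 h2 => (ih _ (hd ▸ h2) x' y' h1 rfl).symm) hxy⟩
  ext x y
  rcases lt_trichotomy x y with hxy | rfl | hxy
  · exact main _ x y hxy rfl
  · exact ⟨fun _ => q.refl x, fun _ => p.refl x⟩
  · exact ⟨fun h => q.symm ((main _ y x hxy rfl).mp (p.symm h)),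
      fun h => p.symm ((main _ y x hxy rfl).mpr (q.symm h))⟩

/-- The amplitude is a linear functional of the indicator function of the colourings that are
constant on blocks. -/
theorem amplitude_segments_eq_sum {m : ℕ} (p : Setoid (Fin m)) (w : Fin m × Bool → Bool) :
    Segment.amplitude w (segments p) = ∑ c : Fin m → Fin 4,
      (if p ≤ Setoid.ker c then (1 : ℂ) else 0) •
        ((List.finRange m).map fun x =>
          Segment.letter w c ⟨x, (x, false), (x, true)⟩).prod := by
  simp only [ite_smul, one_smul, zero_smul]
  rw [← Finset.sum_filter, Finset.sum_subtype (p := fun c => p ≤ Setoid.ker c) _ (by simp),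
    ← Equiv.sum_comp (Setoid.liftEquiv p).symm]
  simp only [Segment.amplitude, segments, List.map_map]
  exact Finset.sum_congr (by ext; simp) fun _ _ => rfl

/-- for `n ≥ 4`, the family of partition matrices indexed by the
non-crossing set partitions of `Fin l ⊕ Fin k` is linearly independent over ℂ. -/
theorem stmt_18 (n k l : ℕ) (hn : 4 ≤ n) :
    LinearIndependent ℂ
      (fun π : {π : Setoid (Fin l ⊕ Fin k) // ¬ Crossing k l π} => Dmat n π.1) := by
  let toFin (π : {π : Setoid (Fin l ⊕ Fin k) // ¬ Crossing k l π}) : Setoid (Fin (l + k)) :=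
    Setoid.comap finSumFinEquiv.symm π.1
  have hnc (π) : NonCrossingSetoid (toFin π) := by
    intro x₁ x₂ x₃ x₄ h₁ h₂ h₃ h₁₃ h₂₄
    by_contra h₁₂
    exact π.2 ⟨x₁, x₂, x₃, x₄, h₁, h₂, h₃, h₁₃, h₂₄, h₁₂⟩
  have hinj : Function.Injective toFin := by
    intro π ρ h
    ext x y
    have := congrArg (fun r : Setoid (Fin (l + k)) => r (finSumFinEquiv x) (finSumFinEquiv y)) h
    simpa [toFin, Setoid.comap_rel] using this
  have hD (π) (c : Fin (l + k) → Fin 4) :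
      Dmat n π.1 (fun x => Fin.castLE hn (c (finSumFinEquiv (Sum.inl x))))
        (fun x => Fin.castLE hn (c (finSumFinEquiv (Sum.inr x)))) =
      if toFin π ≤ Setoid.ker c then (1 : ℂ) else 0 := by
    have helim : (Sum.elim (fun x => Fin.castLE hn (c (finSumFinEquiv (Sum.inl x))))
        (fun x => Fin.castLE hn (c (finSumFinEquiv (Sum.inr x)))) : Fin l ⊕ Fin k → Fin n) =
        fun x => Fin.castLE hn (c (finSumFinEquiv x)) := by
      ext x; cases x <;> rfl
    simp only [Dmat, Matrix.of_apply, helim]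
    refine if_congr ⟨fun h x y hxy => ?_, fun h x y hxy => ?_⟩ rfl rfl
    · simpa [Setoid.ker_def] using h _ _ hxy
    · have : toFin π (finSumFinEquiv x) (finSumFinEquiv y) := by
        simpa [toFin, Setoid.comap_rel] using hxy
      exact congrArg (Fin.castLE hn) (h this)
  rw [linearIndependent_iff']
  intro s g hg
  have hamp (w) : ∑ π ∈ s, g π • Segment.amplitude w (segments (toFin π)) = 0 := by
    simp only [amplitude_segments_eq_sum, ← hD, Finset.smul_sum, smul_smul]
    rw [Finset.sum_comm]
    refine Finset.sum_eq_zero fun c _ => ?_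
    rw [← Finset.sum_smul]
    have := congrFun (congrFun hg fun x => Fin.castLE hn (c (finSumFinEquiv (Sum.inl x))))
      fun x => Fin.castLE hn (c (finSumFinEquiv (Sum.inr x)))
    simp only [Matrix.sum_apply, Matrix.smul_apply, smul_eq_mul, Matrix.zero_apply] at this
    rw [this, zero_smul]
  have harea (π ρ) (w : Fin (l + k) × Bool → Bool) :
      Segment.area legPos w (segments (toFin π)) = Segment.area legPos w (segments (toFin ρ)) := by
    simp [Segment.area, segments, Function.comp_def]
  by_contra! hne
  obtain ⟨π₀, hπ₀, hgπ₀⟩ := hne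
  obtain ⟨π, hπ, hmax⟩ := (s.filter fun π => g π ≠ 0).exists_max_image
    (fun π => Segment.area legPos (legSign (toFin π)) (segments (toFin π)))
    ⟨π₀, by simp [hπ₀, hgπ₀]⟩
  rw [Finset.mem_filter] at hπ
  have hsingle := hamp (legSign (toFin π))
  rw [Finset.sum_eq_single_of_mem π hπ.1] at hsingle
  · exact (smul_ne_zero hπ.2 (hnc π).marked.amplitude_spec.1) hsingle
  intro ρ hρ hρπ
  by_contra h0
  obtain ⟨hgρ, haρ⟩ := smul_ne_zero_iff.mp h0
  obtain ⟨hle, heq⟩ := (hnc ρ).marked.amplitude_spec.2 _ haρ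
  have hle' := hmax ρ (by simp [hρ, hgρ])
  have hsign := heq (le_antisymm hle (by rw [harea ρ π (legSign (toFin π))]; exact hle'))
  refine hρπ (hinj ((hnc ρ).eq_of_legSign_eq (hnc π) (funext fun t => ?_)))
  obtain ⟨x, b⟩ := t
  have hx := hsign ⟨⟦x⟧, (x, false), (x, true)⟩ (by simp [segments])
  cases b
  exacts [hx.1.symm, hx.2.symm]
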